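/- arXiv:2504.18898 — 8 statements merged into one kernel-verified Lean document; each statement's English description precedes it below -/
import Mathlib

section
/- Let n ≥ 1 and m ≥ 0. If p and p' are orthogonal pattern bit vectors of rank n, then for ANY pattern bit vectors q and q' of rank m, the products p ⊙ q and p' ⊙ q' are orthogonal pattern bit vectors of rank n + m (their pointwise XOR takes the value true at exactly 2^(n+m-1) indices). -/
/-- The product `p ⊙ q` of a pattern bit vector `p` of rank `n` with a pattern bit
vector `q` of rank `m`: `(p ⊙ q)(i * 2^m + j) = xor (p i) (q j)`. -/
def pbvProd {n m : ℕ} (p : Fin (2^n) → Bool) (q : Fin (2^m) → Bool) :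
    Fin (2^(n+m)) → Bool :=
  fun k =>
    xor (p ⟨(k : ℕ) / 2^m, by
      have hk : (k : ℕ) < 2^m * 2^n :=
        lt_of_lt_of_eq k.isLt (by rw [pow_add, Nat.mul_comm])
      exact Nat.div_lt_of_lt_mul hk⟩)
      (q ⟨(k : ℕ) % 2^m, Nat.mod_lt _ (by positivity)⟩)

/-- Two pattern bit vectors of rank `n` are orthogonal if their pointwise XOR equals
`true` at exactly `2^(n-1)` of the `2^n` indices. -/
def PBVOrthogonal {n : ℕ} (p q : Fin (2^n) → Bool) : Prop :=
  (Finset.univ.filter fun i => xor (p i) (q i) = true).card = 2^(n-1)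

/-- Flipping the XOR of two orthogonal pattern bit vectors by a constant bit preserves the
number of indices at which it is `true`. -/
lemma PBVOrthogonal.card_filter_xor {n : ℕ} (hn : 1 ≤ n) {p p' : Fin (2^n) → Bool}
    (h : PBVOrthogonal p p') (b : Bool) :
    (Finset.univ.filter fun i => xor (xor (p i) (p' i)) b = true).card = 2^(n-1) := by
  unfold PBVOrthogonal at h
  cases b with
  | false => simpa using h
  | true =>
    have hsum := Finset.card_filter_add_card_filter_not (s := Finset.univ)
      (fun i => xor (p i) (p' i) = true)
    have hpow : 2^n = 2^(n-1) + 2^(n-1) := by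
      rw [← mul_two, ← pow_succ, Nat.sub_add_cancel hn]
    rw [h, Finset.card_univ, Fintype.card_fin] at hsum
    replace hsum := hsum.trans hpow
    simpa using Nat.add_left_cancel hsum

/-- The index bijection `(i, j) ↦ i * 2^m + j`. -/
def pbvIndexEquiv (n m : ℕ) : Fin (2^n) × Fin (2^m) ≃ Fin (2^(n+m)) :=
  finProdFinEquiv.trans (finCongr (pow_add 2 n m).symm)

lemma pbvProd_pbvIndexEquiv {n m : ℕ} (p : Fin (2^n) → Bool) (q : Fin (2^m) → Bool)
    (x : Fin (2^n) × Fin (2^m)) :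
    pbvProd p q (pbvIndexEquiv n m x) = xor (p x.1) (q x.2) := by
  have hdiv : ((x.2 : ℕ) + 2^m * x.1) / 2^m = x.1 := by
    rw [Nat.add_mul_div_left _ _ (by positivity), Nat.div_eq_of_lt x.2.isLt, zero_add]
  have hmod : ((x.2 : ℕ) + 2^m * x.1) % 2^m = x.2 := by
    rw [Nat.add_mul_mod_self_left, Nat.mod_eq_of_lt x.2.isLt]
  simp [pbvProd, pbvIndexEquiv, hdiv, hmod]

/-- If `p` and `p'` are orthogonal pattern bit vectors of rank `n ≥ 1`,
then for any pattern bit vectors `q`, `q'` of rank `m ≥ 0`, the products `p ⊙ q` and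
`p' ⊙ q'` are orthogonal pattern bit vectors of rank `n + m`. -/
theorem products_orthogonal_of_left_orthogonal {n m : ℕ} (hn : 1 ≤ n)
    (p p' : Fin (2^n) → Bool) (q q' : Fin (2^m) → Bool)
    (h : PBVOrthogonal p p') :
    PBVOrthogonal (pbvProd p q) (pbvProd p' q') := by
  have hxor (x : Fin (2^n) × Fin (2^m)) :
      xor (pbvProd p q (pbvIndexEquiv n m x)) (pbvProd p' q' (pbvIndexEquiv n m x)) =
        xor (xor (p x.1) (p' x.1)) (xor (q x.2) (q' x.2)) := by
    simp only [pbvProd_pbvIndexEquiv, Bool.xor_assoc, Bool.xor_left_comm (q x.2)]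
  unfold PBVOrthogonal
  rw [Finset.card_filter, ← (pbvIndexEquiv n m).sum_comp]
  simp only [hxor]
  rw [Fintype.sum_prod_type_right]
  simp only [← Finset.card_filter, h.card_filter_xor hn]
  rw [Finset.sum_const, Finset.card_univ, Fintype.card_fin, smul_eq_mul, ← pow_add]
  congr 1
  omega
end

section
/- Let n ≥ 0 and m ≥ 1. For any pattern bit vector p of rank n and any orthogonal pattern bit vectors q and q' of rank m, the products p ⊙ q and p ⊙ q' are orthogonal pattern bit vectors of rank n + m (their pointwise XOR takes the value true at exactly 2^(n+m-1) indices). -/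
/-- The pointwise XOR of two products with a common left factor depends only on the right
factors. -/
theorem xor_pbvProd {n m : ℕ} (p : Fin (2^n) → Bool) (q q' : Fin (2^m) → Bool)
    (k : Fin (2^(n+m))) :
    xor (pbvProd p q k) (pbvProd p q' k) =
      xor (q ⟨k % 2^m, Nat.mod_lt _ (by positivity)⟩)
        (q' ⟨k % 2^m, Nat.mod_lt _ (by positivity)⟩) := by
  unfold pbvProd
  rw [Bool.xor_left_comm, Bool.xor_assoc, Bool.xor_left_comm, ← Bool.xor_assoc, Bool.xor_self,
    Bool.false_xor]

/-- For any pattern bit vector `p` of rank `n ≥ 0` and any orthogonal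
pattern bit vectors `q`, `q'` of rank `m ≥ 1`, the products `p ⊙ q` and `p ⊙ q'` are
orthogonal pattern bit vectors of rank `n + m`. -/
theorem products_orthogonal_of_right_orthogonal {n m : ℕ} (hm : 1 ≤ m)
    (p : Fin (2^n) → Bool) (q q' : Fin (2^m) → Bool)
    (h : PBVOrthogonal q q') :
    PBVOrthogonal (pbvProd p q) (pbvProd p q') := by
  have hfilter : (Finset.univ.filter fun k : Fin (2^(n+m)) =>
        xor (pbvProd p q k) (pbvProd p q' k) = true).map
          ((finCongr (pow_add 2 n m)).trans finProdFinEquiv.symm).toEmbedding =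
      Finset.univ ×ˢ Finset.univ.filter fun j => xor (q j) (q' j) = true := by
    rw [Finset.map_filter, Finset.map_univ_equiv]
    ext x
    simp only [Finset.mem_filter, Finset.mem_univ, true_and, Finset.mem_product,
      Function.comp_apply]
    generalize hk : ((finCongr (pow_add 2 n m)).trans finProdFinEquiv.symm).symm x = k
    obtain rfl := (Equiv.symm_apply_eq _).mp hk
    exact iff_of_eq (congrArg (· = true) (xor_pbvProd p q q' k))
  unfold PBVOrthogonal at h ⊢
  rw [← Finset.card_map, hfilter, Finset.card_product, h, Finset.card_univ, Fintype.card_fin,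
    ← pow_add, Nat.add_sub_assoc hm]
end

section
/- (Pattern Basis Construction) Let n, m ≥ 1. If P is a pattern basis of rank n and Q is a pattern basis of rank m, then the family R : Fin (2^(n+m)) → (Fin (2^(n+m)) → Bool) defined by R (i * 2^m + j) = P i ⊙ Q j (for i < 2^n, j < 2^m) is a pattern basis of rank n + m; that is, the 2^(n+m) product pattern bit vectors are pairwise orthogonal. -/
/-- The index `i * 2^m + j` as an element of `Fin (2^(n+m))`. -/
def finPair {n m : ℕ} (i : Fin (2^n)) (j : Fin (2^m)) : Fin (2^(n+m)) :=
  ⟨(i : ℕ) * 2^m + (j : ℕ), by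
    calc (i : ℕ) * 2^m + (j : ℕ)
        < (i : ℕ) * 2^m + 2^m := Nat.add_lt_add_left j.isLt _
      _ = ((i : ℕ) + 1) * 2^m := by ring
      _ ≤ 2^n * 2^m := Nat.mul_le_mul_right _ i.isLt
      _ = 2^(n+m) := (pow_add 2 n m).symm⟩

/-- The sign `(-1)^b` of a bit `b`. -/
def bitSign (b : Bool) : ℤ := if b then -1 else 1

theorem bitSign_xor (a b : Bool) : bitSign (xor a b) = bitSign a * bitSign b := by
  cases a <;> cases b <;> rfl

theorem sum_bitSign {ι : Type*} [Fintype ι] (f : ι → Bool) :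
    ∑ i, bitSign (f i) =
      Fintype.card ι - 2 * ((Finset.univ.filter fun i => f i = true).card : ℤ) := by
  have h (i : ι) : bitSign (f i) = 1 - 2 * (if f i = true then 1 else 0) := by
    cases f i <;> rfl
  simp only [h, Finset.sum_sub_distrib, ← Finset.mul_sum, Finset.sum_boole]
  simp

theorem pbvOrthogonal_iff_sum_eq_zero {n : ℕ} (hn : 1 ≤ n) (p q : Fin (2^n) → Bool) :
    PBVOrthogonal p q ↔ ∑ i, bitSign (xor (p i) (q i)) = 0 := by
  rw [sum_bitSign, PBVOrthogonal, Fintype.card_fin]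
  obtain ⟨k, rfl⟩ := Nat.exists_eq_add_of_le' hn
  rw [Nat.add_sub_cancel]
  have h2 : 2^(k + 1) = 2^k * 2 := pow_succ 2 k
  omega

theorem finPair_bijective (n m : ℕ) :
    Function.Bijective fun x : Fin (2^n) × Fin (2^m) => finPair x.1 x.2 := by
  rw [Fintype.bijective_iff_injective_and_card]
  refine ⟨?_, by simp [pow_add]⟩
  rintro ⟨i, j⟩ ⟨i', j'⟩ h
  have h' : (i : ℕ) * 2^m + j = i' * 2^m + j' := congrArg Fin.val h
  have hr := congrArg (· % 2^m) h'
  simp only [Nat.mul_add_mod',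
    Nat.mod_eq_of_lt j.isLt, Nat.mod_eq_of_lt j'.isLt] at hr
  rw [hr] at h'
  have hi : (i : ℕ) = i' :=
    Nat.eq_of_mul_eq_mul_right (by positivity : 0 < 2^m) (Nat.add_right_cancel h')
  exact Prod.ext (Fin.ext hi) (Fin.ext hr)

theorem pbvProd_finPair {n m : ℕ} (p : Fin (2^n) → Bool) (q : Fin (2^m) → Bool)
    (i : Fin (2^n)) (j : Fin (2^m)) : pbvProd p q (finPair i j) = xor (p i) (q j) := by
  have hd : ((i : ℕ) * 2^m + j) / 2^m = i := by
    rw [mul_comm, Nat.mul_add_div (by positivity), Nat.div_eq_of_lt j.isLt, add_zero]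
  have hr : ((i : ℕ) * 2^m + j) % 2^m = j := by
    rw [Nat.mul_add_mod', Nat.mod_eq_of_lt j.isLt]
  simp only [pbvProd, finPair, hd, hr]

theorem sum_bitSign_pbvProd {n m : ℕ} (p p' : Fin (2^n) → Bool) (q q' : Fin (2^m) → Bool) :
    ∑ k, bitSign (xor (pbvProd p q k) (pbvProd p' q' k)) =
      (∑ i, bitSign (xor (p i) (p' i))) * ∑ j, bitSign (xor (q j) (q' j)) := by
  rw [← (finPair_bijective n m).sum_comp, Fintype.sum_mul_sum, Fintype.sum_prod_type]
  refine Finset.sum_congr rfl fun i _ => Finset.sum_congr rfl fun j _ => ?_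
  simp only [pbvProd_finPair, bitSign_xor]
  ring

/-- **Pattern Basis Construction.** If `P` is a pattern basis of rank
`n ≥ 1` and `Q` is a pattern basis of rank `m ≥ 1`, then the family `R` defined by
`R (i * 2^m + j) = P i ⊙ Q j` is a pattern basis of rank `n + m`. -/
theorem pattern_basis_construction {n m : ℕ} (hn : 1 ≤ n) (hm : 1 ≤ m)
    (P : Fin (2^n) → Fin (2^n) → Bool) (Q : Fin (2^m) → Fin (2^m) → Bool)
    (hP : ∀ i j : Fin (2^n), i ≠ j → PBVOrthogonal (P i) (P j))
    (hQ : ∀ i j : Fin (2^m), i ≠ j → PBVOrthogonal (Q i) (Q j))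
    (R : Fin (2^(n+m)) → Fin (2^(n+m)) → Bool)
    (hR : ∀ (i : Fin (2^n)) (j : Fin (2^m)), R (finPair i j) = pbvProd (P i) (Q j)) :
    ∀ k l : Fin (2^(n+m)), k ≠ l → PBVOrthogonal (R k) (R l) := by
  intro k l hkl
  obtain ⟨⟨i, j⟩, rfl⟩ := (finPair_bijective n m).surjective k
  obtain ⟨⟨i', j'⟩, rfl⟩ := (finPair_bijective n m).surjective l
  simp only [hR]
  rw [pbvOrthogonal_iff_sum_eq_zero (by omega), sum_bitSign_pbvProd, mul_eq_zero]
  by_cases hi : i = i'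
  · have hj : j ≠ j' := by
      rintro rfl
      exact hkl (by rw [hi])
    exact Or.inr ((pbvOrthogonal_iff_sum_eq_zero hm _ _).1 (hQ j j' hj))
  · exact Or.inl ((pbvOrthogonal_iff_sum_eq_zero hn _ _).1 (hP i i' hi))
end

section
/- For every n ≥ 1 and every k ∈ Fin (4^n), the pattern bit vector I_{2n} k takes the value true at exactly (4^n - 2^n)/2 of its 4^n indices; in particular, since (4^n - 2^n)/2 ≠ 4^n / 2, every element of I_{2n} is the truth table of an imbalanced Boolean function (the number of inputs mapped to 1 differs from the number mapped to 0). -/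
/-- The base family `I₂`: `p_k i = decide (i = k)` for `k ∈ Fin 4`. -/
def I2base : Fin (2^2) → Fin (2^2) → Bool := fun k i => decide (i = k)

/-- The recursively defined family `I_{2n}`:
`I_{2(n+1)} (i * 4^n + j) = p_i ⊙ I_{2n} j`. -/
def Ifam : (n : ℕ) → Fin (2^(2*n)) → Fin (2^(2*n)) → Bool
  | 0 => fun _ _ => false
  | n+1 => fun k z =>
      pbvProd (n := 2) (m := 2*n)
        (I2base ⟨(k : ℕ) / 2^(2*n), by
          have hk : (k : ℕ) < 2^(2*n) * 2^2 :=
            lt_of_lt_of_eq k.isLt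
              (by rw [show 2*(n+1) = 2*n + 2 from by omega, pow_add])
          exact Nat.div_lt_of_lt_mul hk⟩)
        (Ifam n ⟨(k : ℕ) % 2^(2*n), Nat.mod_lt _ (by positivity)⟩)
        (Fin.cast (congrArg (fun t => 2^t) (by omega : 2*(n+1) = 2 + 2*n)) z)

/-- The signed sum of a Boolean function: inputs mapped to `false` count `1`, inputs mapped
to `true` count `-1`. -/
def signedSum {α : Type*} [Fintype α] (p : α → Bool) : ℤ :=
  ∑ i, if p i = true then -1 else 1

lemma signedSum_eq_card_sub_card {α : Type*} [Fintype α] (p : α → Bool) :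
    signedSum p = ((Finset.univ.filter fun i => p i = false).card : ℤ) -
      (Finset.univ.filter fun i => p i = true).card := by
  rw [signedSum, Finset.sum_ite]
  simp
  ring

lemma signedSum_comp_equiv {α β : Type*} [Fintype α] [Fintype β] (e : α ≃ β) (p : β → Bool) :
    signedSum (fun i => p (e i)) = signedSum p :=
  Equiv.sum_comp e fun i => if p i = true then (-1 : ℤ) else 1

lemma signedSum_xor {α β : Type*} [Fintype α] [Fintype β] (p : α → Bool) (q : β → Bool) :
    signedSum (fun x : α × β => xor (p x.1) (q x.2)) = signedSum p * signedSum q := by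
  simp only [signedSum, Fintype.sum_prod_type, Finset.sum_mul_sum]
  refine Finset.sum_congr rfl fun i _ => Finset.sum_congr rfl fun j _ => ?_
  by_cases hp : p i = true <;> by_cases hq : q j = true <;> simp [hp, hq]

lemma signedSum_pbvProd {n m : ℕ} (p : Fin (2^n) → Bool) (q : Fin (2^m) → Bool) :
    signedSum (pbvProd p q) = signedSum p * signedSum q := by
  rw [← signedSum_xor, ← signedSum_comp_equiv
    ((finCongr (pow_add 2 n m)).trans finProdFinEquiv.symm)]
  rfl

lemma signedSum_I2base (k : Fin (2^2)) : signedSum (I2base k) = 2 := by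
  revert k
  decide

lemma signedSum_Ifam (n : ℕ) (k : Fin (2^(2*n))) : signedSum (Ifam n k) = 2^n := by
  induction n with
  | zero => simp [signedSum, Ifam]
  | succ n ih =>
    unfold Ifam
    refine (signedSum_comp_equiv (finCongr (by ring)) _).trans ?_
    rw [signedSum_pbvProd, signedSum_I2base, ih, pow_succ']

/-- For every `n ≥ 1` and `k`, the pattern bit vector `I_{2n} k` takes
the value `true` at exactly `(4^n - 2^n)/2` of its indices; in particular the number of
inputs mapped to `true` differs from the number mapped to `false` (imbalance). -/
theorem Ifam_imbalanced (n : ℕ) (hn : 1 ≤ n) (k : Fin (2^(2*n))) :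
    (Finset.univ.filter fun z => Ifam n k z = true).card = (4^n - 2^n) / 2 ∧
    (Finset.univ.filter fun z => Ifam n k z = true).card ≠
      (Finset.univ.filter fun z => Ifam n k z = false).card := by
  have hdiff := signedSum_Ifam n k
  rw [signedSum_eq_card_sub_card, sub_eq_iff_eq_add] at hdiff
  have htotal := Finset.card_filter_add_card_filter_not (s := Finset.univ)
    (fun z => Ifam n k z = true)
  simp only [Bool.not_eq_true, Finset.card_univ, Fintype.card_fin] at htotal
  have hpow : 2^(2*n) = 4^n := pow_mul 2 2 n
  have hpos : 0 < 2^n := by positivity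
  norm_cast at hdiff
  omega
end

section
/- (Classification in the Promised Class) For every n ≥ 1 and every i ∈ Fin (4^n), applying the classifier to the pattern ket of the i-th element of I_{2n} yields the i-th standard basis vector: C_{I_{2n}} · a_{I_{2n} i} = e_i, i.e. the j-th entry of C_{I_{2n}} · a_{I_{2n} i} is 1 if j = i and 0 otherwise. Consequently, measuring the BFPQC circuit (which prepares a_{I_{2n} i} from the uniform superposition by one oracle query and then applies C_{I_{2n}}) yields outcome i with probability 1. -/
/-- The pattern ket of a pattern bit vector `p` of rank `n`:
`a_p i = 2^(-(n:ℝ)/2)` if `p i = false` and `a_p i = -2^(-(n:ℝ)/2)` if `p i = true`. -/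
noncomputable def patternKet {n : ℕ} (p : Fin (2^n) → Bool) : Fin (2^n) → ℝ :=
  fun i => if p i then -(2 : ℝ) ^ (-(n : ℝ)/2) else (2 : ℝ) ^ (-(n : ℝ)/2)

/-- The classifier matrix `C_{I₂}`: every diagonal entry is `-1/2`,
every off-diagonal entry is `1/2`. -/
noncomputable def CI2 : Matrix (Fin 4) (Fin 4) ℝ :=
  Matrix.of fun i j => if i = j then -(1/2 : ℝ) else 1/2

/-- Kronecker product of square matrices:
`(A ⊗ B)(i * M + j)(i' * M + j') = A i i' * B j j'`. -/
noncomputable def matKron {N M : ℕ} (A : Matrix (Fin N) (Fin N) ℝ)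
    (B : Matrix (Fin M) (Fin M) ℝ) : Matrix (Fin (N*M)) (Fin (N*M)) ℝ :=
  Matrix.of fun i j => A i.divNat j.divNat * B i.modNat j.modNat

/-- The `n`-fold Kronecker power `C_{I_{2n}}`, defined recursively by
`C_{I_{2(n+1)}} = C_{I₂} ⊗ C_{I_{2n}}`. -/
noncomputable def CIpow : (n : ℕ) → Matrix (Fin (2^(2*n))) (Fin (2^(2*n))) ℝ
  | 0 => 1
  | n+1 =>
      Matrix.of fun i j =>
        matKron CI2 (CIpow n)
          (Fin.cast (by rw [show 2*(n+1) = 2 + 2*n from by omega, pow_add]; norm_num) i)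
          (Fin.cast (by rw [show 2*(n+1) = 2 + 2*n from by omega, pow_add]; norm_num) j)

/-- The index splitting `(a, b) ↦ a * 4^n + b` underlying the recursions for `Ifam` and `CIpow`. -/
def quaternaryDigitEquiv (n : ℕ) : Fin 4 × Fin (2^(2*n)) ≃ Fin (2^(2*(n+1))) :=
  finProdFinEquiv.trans (finCongr (by rw [show 2*(n+1) = 2 + 2*n from by omega, pow_add]; norm_num))

theorem quaternaryDigitEquiv_div (n : ℕ) (x : Fin 4 × Fin (2^(2*n))) :
    (quaternaryDigitEquiv n x : ℕ) / 2^(2*n) = x.1 := by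
  simp [quaternaryDigitEquiv, Nat.add_mul_div_left, Nat.div_eq_of_lt x.2.isLt]

theorem quaternaryDigitEquiv_mod (n : ℕ) (x : Fin 4 × Fin (2^(2*n))) :
    (quaternaryDigitEquiv n x : ℕ) % 2^(2*n) = x.2 := by
  simp [quaternaryDigitEquiv, Nat.mod_eq_of_lt x.2.isLt]

theorem CIpow_succ_apply (n : ℕ) (x y : Fin 4 × Fin (2^(2*n))) :
    CIpow (n+1) (quaternaryDigitEquiv n x) (quaternaryDigitEquiv n y) =
      CI2 x.1 y.1 * CIpow n x.2 y.2 := by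
  have h (z : Fin 4 × Fin (2^(2*n))) (e : 2^(2*(n+1)) = 4 * 2^(2*n)) :
      (Fin.cast e (quaternaryDigitEquiv n z)).divNat = z.1 ∧
        (Fin.cast e (quaternaryDigitEquiv n z)).modNat = z.2 :=
    ⟨Fin.ext (quaternaryDigitEquiv_div n z), Fin.ext (quaternaryDigitEquiv_mod n z)⟩
  simp only [CIpow, matKron, Matrix.of_apply]
  rw [(h x _).1, (h x _).2, (h y _).1, (h y _).2]

theorem Ifam_succ_apply (n : ℕ) (x y : Fin 4 × Fin (2^(2*n))) :
    Ifam (n+1) (quaternaryDigitEquiv n x) (quaternaryDigitEquiv n y) =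
      xor (decide (y.1 = x.1)) (Ifam n x.2 y.2) := by
  simp only [Ifam, pbvProd, I2base, Fin.val_cast, quaternaryDigitEquiv_div,
    quaternaryDigitEquiv_mod, Fin.eta]

theorem patternKet_Ifam_succ (n : ℕ) (x y : Fin 4 × Fin (2^(2*n))) :
    patternKet (Ifam (n+1) (quaternaryDigitEquiv n x)) (quaternaryDigitEquiv n y) =
      CI2 y.1 x.1 * patternKet (Ifam n x.2) y.2 := by
  have h : (2 : ℝ) ^ (-((2*(n+1) : ℕ) : ℝ)/2) = 1/2 * (2 : ℝ) ^ (-((2*n : ℕ) : ℝ)/2) := by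
    rw [show (-((2*(n+1) : ℕ) : ℝ)/2) = -1 + -((2*n : ℕ) : ℝ)/2 by push_cast; ring,
      Real.rpow_add two_pos, Real.rpow_neg_one, one_div]
  simp only [patternKet, Ifam_succ_apply, h, CI2, Matrix.of_apply]
  by_cases hxy : y.1 = x.1 <;> cases Ifam n x.2 y.2 <;> simp [hxy]

theorem CI2_mul_self : CI2 * CI2 = 1 := by
  ext i j
  fin_cases i <;> fin_cases j <;>
    simp [CI2, Matrix.mul_apply, Fin.sum_univ_four] <;> norm_num

theorem CIpow_mulVec_patternKet_Ifam (n : ℕ) (i j : Fin (2^(2*n))) :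
    (CIpow n).mulVec (patternKet (Ifam n i)) j = if j = i then (1 : ℝ) else 0 := by
  induction n with
  | zero =>
    have hij : j = i := Fin.ext (by omega)
    simp [CIpow, patternKet, Ifam, hij]
  | succ n ih =>
    obtain ⟨x, rfl⟩ := (quaternaryDigitEquiv n).surjective i
    obtain ⟨y, rfl⟩ := (quaternaryDigitEquiv n).surjective j
    calc (CIpow (n+1)).mulVec (patternKet (Ifam (n+1) (quaternaryDigitEquiv n x)))
          (quaternaryDigitEquiv n y)
        = (∑ c, CI2 y.1 c * CI2 c x.1) *
            ∑ d, CIpow n y.2 d * patternKet (Ifam n x.2) d := by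
          rw [Matrix.mulVec, dotProduct, ← (quaternaryDigitEquiv n).sum_comp,
            Fintype.sum_prod_type, Finset.sum_mul_sum]
          refine Finset.sum_congr rfl fun c _ => Finset.sum_congr rfl fun d _ => ?_
          rw [CIpow_succ_apply, patternKet_Ifam_succ]
          ring
      _ = (CI2 * CI2) y.1 x.1 * (CIpow n).mulVec (patternKet (Ifam n x.2)) y.2 := rfl
      _ = _ := by
          rw [CI2_mul_self, ih, Matrix.one_apply]
          by_cases h : y.1 = x.1 <;> simp [Prod.ext_iff, h]

/-- **Classification in the Promised Class.** For every `n ≥ 1` and every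
`i`, applying the classifier to the pattern ket of the `i`-th element of `I_{2n}` yields
the `i`-th standard basis vector, so measurement yields outcome `i` with probability 1. -/
theorem classification_in_promised_class (n : ℕ) (hn : 1 ≤ n) (i : Fin (2^(2*n))) :
    (CIpow n).mulVec (patternKet (Ifam n i)) =
      fun j => if j = i then (1 : ℝ) else 0 :=
  funext fun j => CIpow_mulVec_patternKet_Ifam n i j
end

section
/- For every m ≥ 1, the recursively defined family B_{2m} is a pattern basis of rank 2m (its 4^m elements are pairwise orthogonal); moreover its element of index 0 is the constant-false pattern bit vector, and for every k ≠ 0 the element B_{2m} k takes the value true at exactly 2^(2m-1) of its 4^m indices, i.e. it is the truth table of a balanced Boolean function. -/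
/-- The number of `1` bits in the binary representation of a natural number. -/
def Nat.popCount (n : ℕ) : ℕ := (Nat.bits n).count true

/-- The base family `B₂`: `e_k z = decide (Nat.popCount (k &&& z) % 2 = 1)` for `k ∈ Fin 4`. -/
def B2base : Fin (2^2) → Fin (2^2) → Bool :=
  fun k z => decide (Nat.popCount ((k : ℕ) &&& (z : ℕ)) % 2 = 1)

/-- The recursively defined family `B_{2m}`:
`B_{2(m+1)} (i * 4^m + j) = e_i ⊙ B_{2m} j`. -/
def Bfam : (m : ℕ) → Fin (2^(2*m)) → Fin (2^(2*m)) → Bool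
  | 0 => fun _ _ => false
  | m+1 => fun k z =>
      pbvProd (n := 2) (m := 2*m)
        (B2base ⟨(k : ℕ) / 2^(2*m), by
          have hk : (k : ℕ) < 2^(2*m) * 2^2 :=
            lt_of_lt_of_eq k.isLt
              (by rw [show 2*(m+1) = 2*m + 2 from by omega, pow_add])
          exact Nat.div_lt_of_lt_mul hk⟩)
        (Bfam m ⟨(k : ℕ) % 2^(2*m), Nat.mod_lt _ (by positivity)⟩)
        (Fin.cast (congrArg (fun t => 2^t) (by omega : 2*(m+1) = 2 + 2*m)) z)

/-- The sign `(-1)^b` of a Boolean. -/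
def boolSign (b : Bool) : ℤ := if b then -1 else 1

theorem boolSign_xor (a b : Bool) : boolSign (xor a b) = boolSign a * boolSign b := by
  cases a <;> cases b <;> rfl

theorem sum_boolSign {α : Type*} [Fintype α] (f : α → Bool) :
    ∑ z, boolSign (f z) =
      (Fintype.card α : ℤ) - 2 * ((Finset.univ.filter fun z => f z = true).card : ℤ) := by
  have h : ∀ z, boolSign (f z) = 1 - 2 * (if f z = true then 1 else 0) := by
    intro z
    cases f z <;> rfl
  simp only [h, Finset.sum_sub_distrib, ← Finset.mul_sum, Finset.sum_boole]
  simp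

theorem card_filter_eq_of_sum_boolSign_eq_zero {n : ℕ} (hn : 1 ≤ n) (f : Fin (2 ^ n) → Bool)
    (h : ∑ z, boolSign (f z) = 0) :
    (Finset.univ.filter fun z => f z = true).card = 2 ^ (n - 1) := by
  obtain ⟨n, rfl⟩ := Nat.exists_eq_add_of_le' hn
  rw [sum_boolSign, Fintype.card_fin] at h
  rw [Nat.add_sub_cancel]
  have h2 : (2 : ℕ) ^ (n + 1) = 2 * 2 ^ n := pow_succ' 2 n
  omega

/-- Splitting an index of rank `2(m+1)` as `i * 4^m + j`. -/
def indexEquiv (m : ℕ) : Fin (2 ^ 2) × Fin (2 ^ (2 * m)) ≃ Fin (2 ^ (2 * (m + 1))) :=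
  finProdFinEquiv.trans
    (finCongr (by rw [← pow_add, show 2 + 2 * m = 2 * (m + 1) by omega]))

theorem indexEquiv_val (m : ℕ) (x : Fin (2 ^ 2) × Fin (2 ^ (2 * m))) :
    (indexEquiv m x : ℕ) = x.2 + 2 ^ (2 * m) * x.1 := rfl

theorem Bfam_succ_indexEquiv (m : ℕ) (x y : Fin (2 ^ 2) × Fin (2 ^ (2 * m))) :
    Bfam (m + 1) (indexEquiv m x) (indexEquiv m y) =
      xor (B2base x.1 y.1) (Bfam m x.2 y.2) := by
  have hdiv (x : Fin (2 ^ 2) × Fin (2 ^ (2 * m))) :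
      (indexEquiv m x : ℕ) / 2 ^ (2 * m) = x.1 := by
    rw [indexEquiv_val, Nat.add_mul_div_left _ _ (by positivity), Nat.div_eq_of_lt x.2.isLt,
      Nat.zero_add]
  have hmod (x : Fin (2 ^ 2) × Fin (2 ^ (2 * m))) :
      (indexEquiv m x : ℕ) % 2 ^ (2 * m) = x.2 := by
    rw [indexEquiv_val, Nat.add_mul_mod_self_left, Nat.mod_eq_of_lt x.2.isLt]
  simp only [Bfam, pbvProd, Fin.val_cast, hdiv, hmod, Fin.eta]

theorem sum_boolSign_B2base {i j : Fin (2 ^ 2)} (h : i ≠ j) :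
    ∑ z, boolSign (xor (B2base i z) (B2base j z)) = 0 := by
  revert i j
  decide +kernel

theorem sum_boolSign_Bfam (m : ℕ) {k l : Fin (2 ^ (2 * m))} (h : k ≠ l) :
    ∑ z, boolSign (xor (Bfam m k z) (Bfam m l z)) = 0 := by
  induction m with
  | zero => exact absurd (Fin.ext (by have := k.isLt; have := l.isLt; omega)) h
  | succ m ih =>
    obtain ⟨⟨i, j⟩, rfl⟩ := (indexEquiv m).surjective k
    obtain ⟨⟨i', j'⟩, rfl⟩ := (indexEquiv m).surjective l
    have hsum : ∑ z, boolSign (xor (Bfam (m + 1) (indexEquiv m (i, j)) z)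
          (Bfam (m + 1) (indexEquiv m (i', j')) z)) =
        (∑ a, boolSign (xor (B2base i a) (B2base i' a))) *
          ∑ b, boolSign (xor (Bfam m j b) (Bfam m j' b)) := by
      rw [← (indexEquiv m).sum_comp, Fintype.sum_mul_sum, Fintype.sum_prod_type]
      refine Finset.sum_congr rfl fun a _ => Finset.sum_congr rfl fun b _ => ?_
      simp only [Bfam_succ_indexEquiv, boolSign_xor]
      ring
    rw [hsum]
    by_cases hi : i = i'
    · have hj : j ≠ j' := fun hj => h (by rw [hi, hj])
      rw [ih hj, mul_zero]
    · rw [sum_boolSign_B2base hi, zero_mul]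

theorem B2base_zero (z : Fin (2 ^ 2)) : B2base 0 z = false := by
  revert z
  decide +kernel

theorem Bfam_zero_index (m : ℕ) (z : Fin (2 ^ (2 * m))) :
    Bfam m ⟨0, by positivity⟩ z = false := by
  induction m with
  | zero => rfl
  | succ m ih =>
    obtain ⟨y, rfl⟩ := (indexEquiv m).surjective z
    have h0 : (⟨0, by positivity⟩ : Fin (2 ^ (2 * (m + 1)))) =
        indexEquiv m (0, ⟨0, by positivity⟩) := Fin.ext (by rw [indexEquiv_val]; simp)
    rw [h0, Bfam_succ_indexEquiv, ih, B2base_zero, Bool.xor_false]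

/-- For every `m ≥ 1`, the family `B_{2m}` is a pattern basis of rank
`2m`; its element of index `0` is the constant-false pattern bit vector, and for every
`k ≠ 0` the element `B_{2m} k` takes the value `true` at exactly `2^(2m-1)` indices
(it is balanced). -/
theorem Bfam_basis_balanced (m : ℕ) (hm : 1 ≤ m) :
    (∀ k l : Fin (2^(2*m)), k ≠ l → PBVOrthogonal (Bfam m k) (Bfam m l)) ∧
    (Bfam m ⟨0, by positivity⟩ = fun _ => false) ∧
    (∀ k : Fin (2^(2*m)), k ≠ ⟨0, by positivity⟩ →
      (Finset.univ.filter fun z => Bfam m k z = true).card = 2^(2*m - 1)) := by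
  have hn : 1 ≤ 2 * m := by omega
  refine ⟨fun k l hkl => ?_, funext (Bfam_zero_index m), fun k hk => ?_⟩
  · exact card_filter_eq_of_sum_boolSign_eq_zero hn _ (sum_boolSign_Bfam m hkl)
  · refine card_filter_eq_of_sum_boolSign_eq_zero hn _ ?_
    simpa only [Bfam_zero_index, Bool.xor_false] using sum_boolSign_Bfam m hk
end

section
/- For every m ≥ 1 and all k, z ∈ Fin (4^m), the recursively defined element B_{2m} k satisfies B_{2m} k z = decide (Nat.popCount (k &&& z) % 2 = 1); equivalently, the pattern ket of B_{2m} k is the k-th column of the 2m-fold Kronecker power of the Hadamard matrix H = (1/√2) · !![1, 1; 1, -1]: a_{B_{2m} k} z = 2^(-m) * (-1)^(Nat.popCount (k &&& z)). -/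
theorem Nat.popCount_eq_mod_two_add (n : ℕ) : n.popCount = n % 2 + (n / 2).popCount := by
  rcases Nat.eq_zero_or_pos n with rfl | hn
  · simp [Nat.popCount]
  · induction n using Nat.binaryRec' with
    | zero => omega
    | bit b n h _ =>
      rw [Nat.bit_mod_two, Nat.bit_div_two, Nat.popCount, Nat.bits_append_bit n b h]
      cases b <;> simp [Nat.popCount, Nat.add_comm]

/-- Bits split into those above and those below position `s`. -/
theorem Nat.popCount_div_add_mod_two_pow (s n : ℕ) :
    (n / 2 ^ s).popCount + (n % 2 ^ s).popCount = n.popCount := by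
  induction s generalizing n with
  | zero => simp [Nat.mod_one, Nat.popCount]
  | succ s ih =>
    rw [n.popCount_eq_mod_two_add, ← ih (n / 2), (n % 2 ^ (s + 1)).popCount_eq_mod_two_add,
      Nat.mod_mod_of_dvd n (dvd_pow_self 2 s.succ_ne_zero), Nat.div_div_eq_div_mul, pow_succ',
      Nat.mod_mul_right_div_self]
    omega

theorem Bfam_eq_decide_popCount_odd (m : ℕ) (k z : Fin (2^(2*m))) :
    Bfam m k z = decide (Nat.popCount ((k : ℕ) &&& (z : ℕ)) % 2 = 1) := by
  induction m with
  | zero => simp [Bfam, Nat.popCount]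
  | succ m ih =>
    simp only [Bfam, pbvProd, B2base, ih, Fin.val_cast]
    rw [← Nat.popCount_div_add_mod_two_pow (2 * m) ((k : ℕ) &&& (z : ℕ)),
      Nat.and_div_two_pow, Nat.and_mod_two_pow, Bool.eq_iff_iff]
    simp only [bne_iff_ne, ne_eq, decide_eq_decide, decide_eq_true_eq]
    omega

/-- For every `m ≥ 1` and all `k`, `z`, the recursively defined element
`B_{2m} k` satisfies `B_{2m} k z = decide (Nat.popCount (k &&& z) % 2 = 1)`; equivalently,
the pattern ket of `B_{2m} k` is the `k`-th column of the `2m`-fold Kronecker power of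
the Hadamard matrix: `a_{B_{2m} k} z = 2^(-m) * (-1)^(popCount (k &&& z))`. -/
theorem Bfam_hadamard_column (m : ℕ) (hm : 1 ≤ m) (k z : Fin (2^(2*m))) :
    Bfam m k z = decide (Nat.popCount ((k : ℕ) &&& (z : ℕ)) % 2 = 1) ∧
    patternKet (Bfam m k) z =
      ((2 : ℝ)^m)⁻¹ * (-1 : ℝ)^(Nat.popCount ((k : ℕ) &&& (z : ℕ))) := by
  refine ⟨Bfam_eq_decide_popCount_odd m k z, ?_⟩
  have amplitude : (2 : ℝ) ^ (-((2 * m : ℕ) : ℝ) / 2) = ((2 : ℝ) ^ m)⁻¹ := by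
    rw [← Real.rpow_natCast, ← Real.rpow_neg zero_le_two]
    congr 1
    push_cast
    ring
  rw [patternKet, Bfam_eq_decide_popCount_odd, amplitude]
  rcases Nat.even_or_odd (Nat.popCount ((k : ℕ) &&& (z : ℕ))) with h | h
  · simp [h.neg_one_pow, Nat.even_iff.mp h]
  · simp [h.neg_one_pow, Nat.odd_iff.mp h]
end

section
/- (Functions Outside the Promised Class) For every m ≥ 1 and every k ∈ Fin (4^m), every entry of the vector C_{I_{2m}} · a_{B_{2m} k} has absolute value 2^(-m); consequently the squared amplitude of every measurement outcome z ∈ Fin (4^m) of the BFPQC circuit run on the balanced function with truth table B_{2m} k equals 4^(-m), so all 4^m outcomes are equiprobable and classification is probabilistically impossible. -/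
theorem matKron_mulVec {N M : ℕ} (A : Matrix (Fin N) (Fin N) ℝ) (B : Matrix (Fin M) (Fin M) ℝ)
    (f : Fin N → ℝ) (g : Fin M → ℝ) (z : Fin (N * M)) :
    (matKron A B).mulVec (fun w => f w.divNat * g w.modNat) z =
      A.mulVec f z.divNat * B.mulVec g z.modNat := by
  simp only [Matrix.mulVec, dotProduct, matKron, Matrix.of_apply]
  rw [Finset.sum_mul_sum, ← Fintype.sum_prod_type', ← finProdFinEquiv.symm.sum_comp]
  refine Finset.sum_congr rfl fun w _ => ?_
  simp only [finProdFinEquiv_symm_apply]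
  ring

theorem patternKet_pbvProd {n m : ℕ} (p : Fin (2^n) → Bool) (q : Fin (2^m) → Bool)
    (w : Fin (2^n * 2^m)) :
    patternKet (pbvProd p q) (Fin.cast (pow_add 2 n m).symm w) =
      patternKet p w.divNat * patternKet q w.modNat := by
  have h : (2 : ℝ) ^ (-((n + m : ℕ) : ℝ) / 2) =
      (2 : ℝ) ^ (-(n : ℝ) / 2) * (2 : ℝ) ^ (-(m : ℝ) / 2) := by
    rw [← Real.rpow_add two_pos]
    push_cast
    ring_nf
  have hpq : pbvProd p q (Fin.cast (pow_add 2 n m).symm w) = xor (p w.divNat) (q w.modNat) := rfl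
  simp only [patternKet, hpq, h]
  cases p w.divNat <;> cases q w.modNat <;> simp

theorem CIpow_succ_mulVec (n : ℕ) (k z : Fin (2^(2*(n+1)))) :
    ∃ (k₁ z₁ : Fin 4) (k₂ z₂ : Fin (2^(2*n))),
      (CIpow (n+1)).mulVec (patternKet (Bfam (n+1) k)) z =
        CI2.mulVec (patternKet (n := 2) (B2base k₁)) z₁ *
          (CIpow n).mulVec (patternKet (Bfam n k₂)) z₂ := by
  have e : 2^(2*(n+1)) = 4 * 2^(2*n) := by ring
  refine ⟨(Fin.cast e k).divNat, (Fin.cast e z).divNat, (Fin.cast e k).modNat,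
    (Fin.cast e z).modNat, ?_⟩
  rw [← matKron_mulVec]
  simp only [Matrix.mulVec, dotProduct]
  rw [← (finCongr e).sum_comp]
  refine Finset.sum_congr rfl fun w _ => congrArg₂ (· * ·) rfl ?_
  have h := patternKet_pbvProd (n := 2) (m := 2*n) (B2base (Fin.cast e k).divNat)
    (Bfam n (Fin.cast e k).modNat) (Fin.cast e w)
  refine Eq.trans ?_ h
  simp only [patternKet, show 2 * (n + 1) = 2 + 2 * n by ring]
  rfl

theorem abs_sum_sign_B2base (k z : Fin 4) :
    |∑ w : Fin 4, (if z = w then -1 else 1) * (if B2base k w then -1 else 1 : ℤ)| = 2 := by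
  revert k z
  decide +kernel

theorem abs_CI2_mulVec_B2base (k z : Fin 4) :
    |CI2.mulVec (patternKet (n := 2) (B2base k)) z| = 2⁻¹ := by
  have h : (2 : ℝ) ^ (-((2 : ℕ) : ℝ) / 2) = 2⁻¹ := by
    norm_num [Real.rpow_neg_one]
  have hs : CI2.mulVec (patternKet (n := 2) (B2base k)) z = 4⁻¹ *
      ((∑ w : Fin 4, (if z = w then -1 else 1) * (if B2base k w then -1 else 1 : ℤ) : ℤ) : ℝ) := by
    simp only [Matrix.mulVec, dotProduct, patternKet, h, CI2, Matrix.of_apply]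
    rw [Int.cast_sum, Finset.mul_sum]
    refine Finset.sum_congr rfl fun w _ => ?_
    split_ifs <;> norm_num
  rw [hs, abs_mul, ← Int.cast_abs, abs_sum_sign_B2base]
  norm_num

theorem abs_CIpow_mulVec_Bfam (m : ℕ) (k z : Fin (2^(2*m))) :
    |(CIpow m).mulVec (patternKet (Bfam m k)) z| = ((2 : ℝ)^m)⁻¹ := by
  induction m with
  | zero => simp [CIpow, patternKet, Bfam]
  | succ n ih =>
    obtain ⟨k₁, z₁, k₂, z₂, h⟩ := CIpow_succ_mulVec n k z
    rw [h, abs_mul, abs_CI2_mulVec_B2base, ih, pow_succ', mul_inv]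

/-- **Functions Outside the Promised Class.** For every `m ≥ 1` and
`k`, every entry of `C_{I_{2m}} · a_{B_{2m} k}` has absolute value `2^(-m)`; hence the
squared amplitude of every measurement outcome `z` equals `4^(-m)`, so all `4^m`
outcomes are equiprobable. -/
theorem balanced_outcomes_equiprobable (m : ℕ) (hm : 1 ≤ m) (k : Fin (2^(2*m))) :
    ∀ z : Fin (2^(2*m)),
      |(CIpow m).mulVec (patternKet (Bfam m k)) z| = ((2 : ℝ)^m)⁻¹ ∧
      ((CIpow m).mulVec (patternKet (Bfam m k)) z)^2 = ((4 : ℝ)^m)⁻¹ := by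
  intro z
  have h := abs_CIpow_mulVec_Bfam m k z
  refine ⟨h, ?_⟩
  rw [← sq_abs, h, inv_pow, ← pow_mul, mul_comm, pow_mul]
  norm_num
end
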